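/- For every integer s ≥ 1, the integral J_2 = ∫_{0}^{1} (1 − v/(2s+1))^{2s} (1 + v/(s+1))^{s+1} dv satisfies J_2 ≥ 1. -/

import Mathlib

lemma aux_log_sub (x : ℝ) (h0 : 0 ≤ x) (h1 : x ≤ 1/3) :
    -x - x^2/2 - 3/2*x^3 ≤ Real.log (1 - x) := by
  have h := Real.abs_log_sub_add_sum_range_le (x := x) (by rw [abs_of_nonneg h0]; linarith) 2
  rw [abs_of_nonneg h0] at h
  have h2 := (abs_le.mp h).1
  simp [Finset.sum_range_succ] at h2
  have h3 : x^3/(1-x) ≤ 3/2*x^3 := by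
    rw [div_le_iff₀ (by linarith)]
    have : 0 ≤ x^3 := by positivity
    nlinarith
  norm_num at h2
  linarith

lemma aux_log_add (x : ℝ) (h0 : 0 ≤ x) : x - x^2/2 ≤ Real.log (1 + x) := by
  refine le_trans ?_ (Real.le_log_one_add_of_nonneg h0)
  rw [le_div_iff₀ (by linarith)]
  have : 0 ≤ x^3 := by positivity
  nlinarith

/-- For every integer `s ≥ 1`,
`J_2 = ∫_0^1 (1 - v/(2s+1))^{2s} (1 + v/(s+1))^{s+1} dv ≥ 1`. -/
theorem J2_ge_one (s : ℕ) (hs : 1 ≤ s) :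
    (∫ v in (0:ℝ)..1,
        (1 - v / (2 * (s : ℝ) + 1)) ^ (2 * s) * (1 + v / ((s : ℝ) + 1)) ^ (s + 1)) ≥ 1 := by
  have hs' : (1:ℝ) ≤ s := by exact_mod_cast hs
  set t : ℝ := (s : ℝ) with ht
  let A : ℝ := 1 / (2*t+1)
  let B : ℝ := -(2*t/(2*t+1)^2 + 1/(t+1))/2
  let C : ℝ := -3*t/(2*t+1)^3
  have key : ∀ v ∈ Set.Icc (0:ℝ) 1, 1 + A*v + B*v^2 + C*v^3 ≤
      (1 - v / (2 * t + 1)) ^ (2 * s) * (1 + v / (t + 1)) ^ (s + 1) := by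
    rintro v ⟨hv0, hv1⟩
    have hx0 : 0 ≤ v / (2*t+1) := by positivity
    have hx1 : v / (2*t+1) ≤ 1/3 := by
      rw [div_le_iff₀ (by linarith)]; linarith
    have hy0 : 0 ≤ v / (t+1) := by positivity
    have p1 : 0 < 1 - v / (2*t+1) := by linarith
    have p2 : 0 < 1 + v / (t+1) := by linarith
    have l1 := mul_le_mul_of_nonneg_left (aux_log_sub _ hx0 hx1) (by linarith : 0 ≤ 2*t)
    have l2 := mul_le_mul_of_nonneg_left (aux_log_add _ hy0) (by linarith : 0 ≤ t+1)
    have h := Real.log_le_sub_one_of_pos (mul_pos (pow_pos p1 (2*s)) (pow_pos p2 (s+1)))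
    rw [Real.log_mul (pow_pos p1 _).ne' (pow_pos p2 _).ne', Real.log_pow, Real.log_pow] at h
    push_cast at h
    rw [← ht] at h
    have e : A*v + B*v^2 + C*v^3 = 2*t*(-(v/(2*t+1)) - (v/(2*t+1))^2/2 - 3/2*(v/(2*t+1))^3)
        + (t+1)*(v/(t+1) - (v/(t+1))^2/2) := by
      simp only [A, B, C]
      field_simp
      ring
    linarith
  have hI : ∫ v in (0:ℝ)..1, (1 + A*v + B*v^2 + C*v^3) = 1 + A/2 + B/3 + C/4 := by
    rw [intervalIntegral.integral_add, intervalIntegral.integral_add,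
      intervalIntegral.integral_add]
    · have e1 : ∫ x in (0:ℝ)..1, A * x = A * (1/2) := by
        rw [intervalIntegral.integral_const_mul A (fun x : ℝ => x), integral_id]
        norm_num
      simp only [e1, intervalIntegral.integral_const_mul, integral_pow,
        intervalIntegral.integral_const]
      norm_num
      ring
    all_goals exact Continuous.intervalIntegrable (by fun_prop) _ _
  have hm := intervalIntegral.integral_mono_on (μ := MeasureTheory.volume) (zero_le_one' ℝ)
    (Continuous.intervalIntegrable (by fun_prop) _ _)
    (Continuous.intervalIntegrable (by fun_prop) _ _) key
  rw [hI] at hm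
  have hp : 0 ≤ A/2 + B/3 + C/4 := by
    have : A/2 + B/3 + C/4 = (3*(2*t+1)^2+4*(2*t+1)+9) / (48*(2*t+1)^3*(t+1)) := by
      simp only [A, B, C]
      field_simp
      ring
    rw [this]; positivity
  linarith
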